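/- Let n ≥ 2, let a ≥ 1 be an integer, and let M be a nilpotent representation of C_n over F_q satisfying Hom(M, S_j) = 0 = Ext^1(M, S_j) for all 2 ≤ j ≤ n−1. Then Σ_{[N] : ℓ(N) = ℓ(M)+1} |Ext^1(M, S_0^{(an)})_N| = |Hom(M, S_0^{(an)})| / |Ext^1(M, S_0^{(n−1)})|, where the sum runs over isomorphism classes [N] of nilpotent representations of C_n with ℓ(N) = ℓ(M)+1 (only finitely many terms are nonzero). -/

import Mathlib

open DirectSum

noncomputable section

/-- A finite-dimensional representation of the cyclic quiver `C_n` over a field `F`: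
finite-dimensional `F`-vector spaces `V j` for `j : ZMod n` and linear maps
`x j : V j → V (j - 1)` (one arrow `j → j - 1` for each vertex). -/
structure CRep (F : Type) [Field F] (n : ℕ) : Type 1 where
  V : ZMod n → Type
  [acg : ∀ j, AddCommGroup (V j)]
  [mod : ∀ j, Module F (V j)]
  [fin : ∀ j, Module.Finite F (V j)]
  x : ∀ j : ZMod n, V j →ₗ[F] V (j - 1)

attribute [instance] CRep.acg CRep.mod CRep.fin

namespace CRep

variable {F : Type} [Field F] {n : ℕ}

/-- Morphisms of representations of `C_n`. -/
structure Hom (M N : CRep F n) : Type where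
  f : ∀ j, M.V j →ₗ[F] N.V j
  comm : ∀ j, (f (j - 1)).comp (M.x j) = (N.x j).comp (f j)

/-- The endomorphism of the total space `⨁ j, V j` induced by the maps `x j`. -/
def total (M : CRep F n) : Module.End F (⨁ j, M.V j) :=
  DirectSum.toModule F (ZMod n) (⨁ j, M.V j)
    (fun j => (DirectSum.lof F (ZMod n) M.V (j - 1)).comp (M.x j))

/-- A representation is nilpotent if the composite of its structure maps around the
cycle is nilpotent, i.e. the induced endomorphism of `⨁ j, V j` is nilpotent. -/
def IsNilpotentRep (M : CRep F n) : Prop := IsNilpotent M.total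

/-- Isomorphism of representations. -/
def Iso (M N : CRep F n) : Prop := ∃ φ : Hom M N, ∀ j, Function.Bijective (φ.f j)

/-- The zero representations. -/
def IsZero (M : CRep F n) : Prop := ∀ j, Subsingleton (M.V j)

/-- Direct sum of two representations. -/
def prod (M N : CRep F n) : CRep F n where
  V j := M.V j × N.V j
  x j := (M.x j).prodMap (N.x j)

/-- Finite direct sums of representations. -/
def pi {ι : Type} [Fintype ι] (W : ι → CRep F n) : CRep F n where
  V j := ∀ i, (W i).V j
  x j := LinearMap.pi fun i =>
    ((W i).x j).comp (LinearMap.proj (R := F) (φ := fun i' => (W i').V j) i)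

/-- Indecomposability. -/
def Indecomp (M : CRep F n) : Prop :=
  ¬ M.IsZero ∧ ∀ A B : CRep F n, M.Iso (A.prod B) → A.IsZero ∨ B.IsZero

/-- `M` decomposes into exactly `k` indecomposable direct summands, i.e. `ℓ(M) = k`
(this is well defined by the Krull–Schmidt theorem). -/
def hasLen (M : CRep F n) (k : ℕ) : Prop :=
  ∃ W : Fin k → CRep F n, (∀ i, Indecomp (W i)) ∧ M.Iso (pi W)

/-- Total dimension (= length, since all composition factors are 1-dimensional). -/
def totalDim [NeZero n] (M : CRep F n) : ℕ := ∑ j : ZMod n, Module.finrank F (M.V j)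

/-- `X ≅ S_j^{(a)}`, the unique indecomposable nilpotent representation of length `a`
with top `S_j` (interpreted as the zero representation for `a = 0`): `X` is nilpotent,
indecomposable, of length `a`, and its top is concentrated at `j`, i.e. the structure
map into the vertex `j` is not surjective. -/
def IsSja [NeZero n] (j : ZMod n) (a : ℕ) (X : CRep F n) : Prop :=
  if a = 0 then X.IsZero
  else X.IsNilpotentRep ∧ X.Indecomp ∧ X.totalDim = a ∧
    ¬ Function.Surjective (X.x (j + 1))

/-- `|Hom(M,N)|`. -/
def homCount (M N : CRep F n) : ℕ := Nat.card (Hom M N)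

/-- `|Aut(M)|`. -/
def autCount (M : CRep F n) : ℕ :=
  Nat.card {φ : Hom M M // ∀ j, Function.Bijective (φ.f j)}

/-- Short exact sequences `0 → N → E → M → 0` of representations. -/
structure SES (N M : CRep F n) : Type 1 where
  E : CRep F n
  i : Hom N E
  p : Hom E M
  inj : ∀ j, Function.Injective (i.f j)
  surj : ∀ j, Function.Surjective (p.f j)
  exct : ∀ j, LinearMap.range (i.f j) = LinearMap.ker (p.f j)

/-- Baer equivalence of short exact sequences (a morphism of middle terms commuting
with the identities of `N` and `M`; such a morphism is automatically an isomorphism). -/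
def BaerEq {N M : CRep F n} (s s' : SES N M) : Prop :=
  ∃ φ : Hom s.E s'.E,
    (∀ j, (φ.f j).comp (s.i.f j) = s'.i.f j) ∧
    (∀ j, (s'.p.f j).comp (φ.f j) = s.p.f j)

/-- The number of Baer equivalence classes of extensions `0 → N → E → M → 0` whose
middle term `E` satisfies `P`.  For `P = fun _ => True` this is `|Ext¹(M,N)|`; for
`P = iso class of L` it is `|Ext¹(M,N)_L|`; for `P = fun E => hasLen E k` it is
`Σ_{[L] : ℓ(L) = k} |Ext¹(M,N)_L|`. -/
def extCount (N M : CRep F n) (P : CRep F n → Prop) : ℕ :=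
  Nat.card (Quot fun s s' : {s : SES N M // P s.E} => BaerEq s.1 s'.1)

/-- A short exact sequence splits. -/
def SES.Splits {N M : CRep F n} (s : SES N M) : Prop :=
  ∃ σ : Hom M s.E, ∀ j, (s.p.f j).comp (σ.f j) = LinearMap.id

end CRep

namespace CRep

variable {F : Type} [Field F] {n : ℕ}

/-! ### The total space and nilpotency -/

@[simp]
lemma total_lof (M : CRep F n) (j : ZMod n) (v : M.V j) :
    M.total (lof F (ZMod n) M.V j v) = lof F (ZMod n) M.V (j - 1) (M.x j v) := by
  simp [total]

lemma component_total (M : CRep F n) (j : ZMod n) (t : ⨁ j, M.V j) :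
    component F (ZMod n) M.V (j - 1) (M.total t) = M.x j (component F (ZMod n) M.V j t) := by
  suffices h : (component F (ZMod n) M.V (j - 1)).comp M.total
      = (M.x j).comp (component F (ZMod n) M.V j) from LinearMap.congr_fun h t
  refine DirectSum.linearMap_ext F fun i => LinearMap.ext fun w => ?_
  simp only [LinearMap.comp_apply, total_lof]
  by_cases h : i = j
  · subst h
    simp [component.lof_self]
  · rw [component.of, component.of, dif_neg h, dif_neg (by simpa using h), map_zero]

lemma exists_total_pow_lof (M : CRep F n) (m : ℕ) (j : ZMod n) (v : M.V j) :
    ∃ (p : ZMod n) (u : M.V p),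
      (M.total ^ m) (lof F (ZMod n) M.V j v) = lof F (ZMod n) M.V p u := by
  induction m with
  | zero => exact ⟨j, v, by simp⟩
  | succ m ih =>
    obtain ⟨p, u, h⟩ := ih
    exact ⟨p - 1, M.x p u, by rw [pow_succ', Module.End.mul_apply, h, total_lof]⟩

/-- The map induced on total spaces by a morphism of representations. -/
def Hom.total {M N : CRep F n} (φ : Hom M N) : (⨁ j, M.V j) →ₗ[F] ⨁ j, N.V j :=
  DirectSum.lmap φ.f

lemma Hom.total_comm {M N : CRep F n} (φ : Hom M N) (t : ⨁ j, M.V j) :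
    φ.total (M.total t) = N.total (φ.total t) := by
  suffices h : φ.total.comp M.total = N.total.comp φ.total from LinearMap.congr_fun h t
  refine DirectSum.linearMap_ext F fun i => LinearMap.ext fun w => ?_
  have := LinearMap.congr_fun (φ.comm i) w
  simp only [LinearMap.comp_apply] at this
  simp [Hom.total, this]

lemma Hom.total_pow_comm {M N : CRep F n} (φ : Hom M N) (m : ℕ) (t : ⨁ j, M.V j) :
    φ.total ((M.total ^ m) t) = (N.total ^ m) (φ.total t) := by
  induction m generalizing t with
  | zero => simp
  | succ m ih => simp only [pow_succ, Module.End.mul_apply, ih, φ.total_comm]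

lemma IsNilpotentRep.of_surjective {M N : CRep F n} (hM : M.IsNilpotentRep) (φ : Hom M N)
    (hφ : ∀ j, Function.Surjective (φ.f j)) : N.IsNilpotentRep := by
  obtain ⟨m, hm⟩ := hM
  refine ⟨m, LinearMap.ext fun t => ?_⟩
  obtain ⟨s, rfl⟩ := (lmap_surjective φ.f).2 hφ t
  have := φ.total_pow_comm m s
  rw [hm] at this
  simpa [Hom.total] using this.symm

lemma SES.isNilpotentRep {N M : CRep F n} (s : SES N M) (hN : N.IsNilpotentRep)
    (hM : M.IsNilpotentRep) : s.E.IsNilpotentRep := by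
  obtain ⟨a, ha⟩ := hN
  obtain ⟨b, hb⟩ := hM
  refine ⟨a + b, LinearMap.ext fun t => ?_⟩
  have h1 : s.p.total ((s.E.total ^ b) t) = 0 := by rw [s.p.total_pow_comm, hb]; rfl
  obtain ⟨u, hu⟩ : ∃ u, s.i.total u = (s.E.total ^ b) t := by
    have hmem : ∀ j, ∃ w, s.i.f j w = ((s.E.total ^ b) t) j := fun j => by
      have hj : s.p.f j (((s.E.total ^ b) t) j) = 0 := by
        have := congrArg (fun z => z j) h1
        simpa [Hom.total] using this
      have : ((s.E.total ^ b) t) j ∈ LinearMap.range (s.i.f j) := by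
        rw [s.exct j]; exact hj
      exact this
    have : (s.E.total ^ b) t ∈ LinearMap.range (DirectSum.lmap s.i.f) := by
      rw [DirectSum.range_lmap]
      simpa using hmem
    exact this
  rw [pow_add, Module.End.mul_apply, ← hu, ← s.i.total_pow_comm, ha]
  simp

/-! ### Subrepresentations and Fitting's lemma -/

/-- The subrepresentation on a stable family of subspaces. -/
def sub (M : CRep F n) (U : ∀ j, Submodule F (M.V j))
    (hU : ∀ j, ∀ v ∈ U j, M.x j v ∈ U (j - 1)) : CRep F n where
  V j := U j
  x j := (M.x j).restrict (hU j)

lemma iso_prod_sub (M : CRep F n) (U C : ∀ j, Submodule F (M.V j))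
    (hU : ∀ j, ∀ v ∈ U j, M.x j v ∈ U (j - 1)) (hC : ∀ j, ∀ v ∈ C j, M.x j v ∈ C (j - 1))
    (h : ∀ j, IsCompl (U j) (C j)) : M.Iso ((M.sub U hU).prod (M.sub C hC)) := by
  refine ⟨⟨fun j => ((U j).prodEquivOfIsCompl (C j) (h j)).symm.toLinearMap, fun j => ?_⟩,
    fun j => ((U j).prodEquivOfIsCompl (C j) (h j)).symm.bijective⟩
  refine LinearMap.ext fun v => ?_
  obtain ⟨⟨u, c⟩, rfl⟩ := ((U j).prodEquivOfIsCompl (C j) (h j)).surjective v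
  change ((U (j - 1)).prodEquivOfIsCompl (C (j - 1)) (h (j - 1))).symm _ =
    ((M.x j).restrict (hU j)).prodMap ((M.x j).restrict (hC j))
      (((U j).prodEquivOfIsCompl (C j) (h j)).symm _)
  rw [LinearEquiv.symm_apply_apply, LinearEquiv.symm_apply_eq]
  simp

/-- Fitting's lemma: an endomorphism of an indecomposable representation is bijective or
nilpotent. -/
lemma Indecomp.bijective_or_nilpotent [NeZero n] {W : CRep F n} (hW : W.Indecomp)
    (f : Hom W W) :
    (∀ j, Function.Bijective (f.f j)) ∨ ∃ m : ℕ, ∀ j, (f.f j) ^ m = 0 := by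
  have hev : ∀ᶠ m in Filter.atTop, ∀ j,
      IsCompl (LinearMap.ker ((f.f j) ^ m)) (LinearMap.range ((f.f j) ^ m)) :=
    Filter.eventually_all.2 fun j => LinearMap.eventually_isCompl_ker_pow_range_pow (f.f j)
  obtain ⟨m, hm, hm1⟩ := (hev.and (Filter.eventually_ge_atTop 1)).exists
  have hc : ∀ (m : ℕ) j v, ((f.f (j - 1)) ^ m) (W.x j v) = W.x j (((f.f j) ^ m) v) := by
    intro m j
    induction m with
    | zero => simp
    | succ m ih =>
      intro v
      have := LinearMap.congr_fun (f.comm j) v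
      simp only [LinearMap.comp_apply] at this
      rw [pow_succ, pow_succ, Module.End.mul_apply, Module.End.mul_apply, this, ih]
  have hiso := iso_prod_sub W _ _
    (fun j v (hv : v ∈ LinearMap.ker ((f.f j) ^ m)) => by
      rw [LinearMap.mem_ker] at hv ⊢; rw [hc, hv, map_zero])
    (fun j v (hv : v ∈ LinearMap.range ((f.f j) ^ m)) => by
      obtain ⟨w, rfl⟩ := hv
      exact ⟨W.x j w, hc m j w⟩) hm
  rcases hW.2 _ _ hiso with h | h
  · left
    intro j
    have hb : LinearMap.ker ((f.f j) ^ m) = ⊥ := Submodule.subsingleton_iff_eq_bot.1 (h j)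
    have hinj : Function.Injective (f.f j) := by
      obtain ⟨m, rfl⟩ : ∃ l, m = l + 1 := ⟨m - 1, by omega⟩
      rw [pow_succ, LinearMap.ker_eq_bot, Module.End.coe_mul] at hb
      exact hb.of_comp
    exact ⟨hinj, LinearMap.injective_iff_surjective.1 hinj⟩
  · right
    exact ⟨m, fun j => LinearMap.range_eq_bot.1 (Submodule.subsingleton_iff_eq_bot.1 (h j))⟩

/-! ### The dimension of the top -/

/-- The dimension of the top `M / rad M`. -/
def topDim [NeZero n] (M : CRep F n) : ℕ :=
  ∑ j, Module.finrank F (M.V (j - 1) ⧸ LinearMap.range (M.x j))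

lemma IsNilpotentRep.isZero_of_surjective {M : CRep F n} (hM : M.IsNilpotentRep)
    (h : ∀ j, Function.Surjective (M.x j)) : M.IsZero := by
  have hs : Function.Surjective M.total := by
    rw [← LinearMap.range_eq_top, eq_top_iff]
    rintro t -
    induction t using DirectSum.induction_on with
    | zero => exact zero_mem _
    | add a b ha hb => exact add_mem ha hb
    | of i v =>
      obtain ⟨i, rfl⟩ : ∃ k, i = k - 1 := ⟨i + 1, by ring⟩
      obtain ⟨w, rfl⟩ := h i v
      exact ⟨lof F (ZMod n) M.V i w, total_lof M i w⟩
  obtain ⟨m, hm⟩ := hM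
  have hsm : Function.Surjective (M.total ^ m) := by
    rw [Module.End.coe_pow]; exact hs.iterate m
  intro j
  refine subsingleton_of_forall_eq 0 fun v => ?_
  obtain ⟨t, ht⟩ := hsm (lof F (ZMod n) M.V j v)
  rw [hm] at ht
  have := congrArg (component F (ZMod n) M.V j) ht
  simpa [component.lof_self] using this.symm

/-- A nilpotent indecomposable representation has a simple top. -/
lemma Indecomp.topDim_eq_one [NeZero n] {W : CRep F n} (hW : W.Indecomp)
    (hN : W.IsNilpotentRep) : W.topDim = 1 := by
  classical
  have hge : W.topDim ≠ 0 := by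
    intro h0
    rw [topDim, Finset.sum_eq_zero_iff] at h0
    refine hW.1 (hN.isZero_of_surjective fun j => ?_)
    have := h0 j (Finset.mem_univ _)
    rw [Module.finrank_zero_iff, Submodule.Quotient.subsingleton_iff] at this
    exact LinearMap.range_eq_top.1 this
  suffices hle : W.topDim ≤ 1 by omega
  obtain ⟨L, hL0, hL⟩ : ∃ L, W.total ^ L ≠ 0 ∧ W.total ^ (L + 1) = 0 := by
    have hex : ∃ m, W.total ^ m = 0 := hN
    have h1 : Nat.find hex ≠ 0 := by
      intro h
      have h2 := Nat.find_spec hex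
      rw [h, pow_zero] at h2
      refine hW.1 fun j => subsingleton_of_forall_eq 0 fun v => ?_
      have := congrArg (component F (ZMod n) W.V j)
        (LinearMap.congr_fun h2 (lof F (ZMod n) W.V j v))
      simpa [component.lof_self] using this
    refine ⟨Nat.find hex - 1, Nat.find_min hex (by omega), ?_⟩
    rw [show Nat.find hex - 1 + 1 = Nat.find hex by omega]
    exact Nat.find_spec hex
  obtain ⟨i, v, hv⟩ : ∃ i v, (W.total ^ L) (lof F (ZMod n) W.V i v) ≠ 0 := by
    by_contra! h
    exact hL0 (DirectSum.linearMap_ext F fun i => LinearMap.ext fun v => by simpa using h i v)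
  obtain ⟨p, u, hpu⟩ := W.exists_total_pow_lof L i v
  rw [hpu] at hv
  obtain ⟨φ, hφ⟩ := Module.Projective.exists_dual_ne_zero F hv
  set vv := lof F (ZMod n) W.V i v with hvv
  set r : Module.End F (⨁ j, W.V j) := ∑ m ∈ Finset.range (L + 1),
    (φ.comp (W.total ^ m)).smulRight ((W.total ^ (L - m)) vv) with hr
  have hr_apply : ∀ t, r t = ∑ m ∈ Finset.range (L + 1),
      φ ((W.total ^ m) t) • (W.total ^ (L - m)) vv := by
    intro t; simp [hr, LinearMap.sum_apply]
  have hL' : ∀ t, W.total ((W.total ^ L) t) = 0 := by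
    intro t
    rw [← Module.End.mul_apply, ← pow_succ', hL]; rfl
  have hL'' : ∀ t, (W.total ^ L) (W.total t) = 0 := by
    intro t
    rw [← Module.End.mul_apply, ← pow_succ, hL]; rfl
  have hcomm : ∀ t, r (W.total t) = W.total (r t) := by
    intro t
    rw [hr_apply, hr_apply, Finset.sum_range_succ, Finset.sum_range_succ', map_add, map_sum,
      map_smul, hL'']
    simp only [map_zero, zero_smul, add_zero, Nat.sub_zero, hL', smul_zero]
    refine Finset.sum_congr rfl fun m hm => ?_
    have hm' := Finset.mem_range.1 hm
    rw [map_smul, ← Module.End.mul_apply, ← Module.End.mul_apply, ← pow_succ, ← pow_succ',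
      show L - (m + 1) + 1 = L - m by omega]
  let R : Hom W W := ⟨fun j => (component F (ZMod n) W.V j) ∘ₗ r ∘ₗ (lof F (ZMod n) W.V j), by
    intro j
    ext w
    simp only [LinearMap.comp_apply]
    rw [← total_lof, hcomm, component_total]⟩
  have hRu : R.f p u = φ (lof F (ZMod n) W.V p u) • u := by
    have hx : ∀ m, m ≠ 0 → (W.total ^ m) (lof F (ZMod n) W.V p u) = 0 := by
      intro m hm
      obtain ⟨m, rfl⟩ : ∃ l, m = l + 1 := ⟨m - 1, by omega⟩
      rw [← hpu, pow_succ, Module.End.mul_apply, hL', map_zero]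
    have : r (lof F (ZMod n) W.V p u)
        = φ (lof F (ZMod n) W.V p u) • lof F (ZMod n) W.V p u := by
      rw [hr_apply, Finset.sum_eq_single 0]
      · simp [hpu]
      · intro m _ hm; rw [hx m hm]; simp
      · simp
    change component F (ZMod n) W.V p (r (lof F (ZMod n) W.V p u)) = _
    rw [this, map_smul, component.lof_self]
  have hu : u ≠ 0 := by rintro rfl; simp at hv
  have hbij : ∀ j, Function.Bijective (R.f j) := by
    rcases hW.bijective_or_nilpotent R with h | ⟨m, h⟩
    · exact h
    · exfalso
      have : ∀ m : ℕ, ((R.f p) ^ m) u = φ (lof F (ZMod n) W.V p u) ^ m • u := by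
        intro m
        induction m with
        | zero => simp
        | succ m ih => rw [pow_succ, Module.End.mul_apply, hRu, map_smul, ih, smul_smul, pow_succ']
      have h2 := this m
      rw [h p, LinearMap.zero_apply] at h2
      exact (smul_ne_zero (pow_ne_zero m hφ) hu) h2.symm
  have key : ∀ j, Module.finrank F (W.V (j - 1) ⧸ LinearMap.range (W.x j))
      ≤ if j = i + 1 then 1 else 0 := by
    intro j
    have hmem : ∀ w, ∃ c : F, w - c • component F (ZMod n) W.V (j - 1) vv
        ∈ LinearMap.range (W.x j) := by
      intro w
      obtain ⟨w', rfl⟩ := (hbij (j - 1)).2 w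
      refine ⟨φ ((W.total ^ L) (lof F (ZMod n) W.V (j - 1) w')), ?_⟩
      change component F (ZMod n) W.V (j - 1) (r _) - _ ∈ _
      rw [hr_apply, Finset.sum_range_succ, map_add, Nat.sub_self, pow_zero, Module.End.one_apply,
        map_smul, add_sub_cancel_right, map_sum]
      refine sum_mem fun m hm => ?_
      have hm' := Finset.mem_range.1 hm
      rw [map_smul]
      refine Submodule.smul_mem _ _ ?_
      rw [show L - m = L - m - 1 + 1 by omega, pow_succ', Module.End.mul_apply, component_total]
      exact ⟨_, rfl⟩
    split_ifs with hj
    · refine finrank_le_one (Submodule.Quotient.mk (component F (ZMod n) W.V (j - 1) vv)) ?_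
      intro w
      obtain ⟨w, rfl⟩ := Submodule.Quotient.mk_surjective _ w
      obtain ⟨c, hc⟩ := hmem w
      exact ⟨c, by
        rw [← Submodule.Quotient.mk_smul]
        exact ((Submodule.Quotient.eq _).2 hc).symm⟩
    · rw [Nat.le_zero, Module.finrank_zero_iff, Submodule.Quotient.subsingleton_iff,
        eq_top_iff]
      rintro w -
      obtain ⟨c, hc⟩ := hmem w
      rw [hvv, component.of, dif_neg (fun h => hj (by rw [h]; ring)), smul_zero, sub_zero] at hc
      exact hc
  calc W.topDim ≤ ∑ j, (if j = i + 1 then 1 else 0) := Finset.sum_le_sum fun j _ => key j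
    _ = 1 := by simp

end CRep

namespace CRep

variable {F : Type} [Field F] {n : ℕ}

/-! ### The number of indecomposable summands -/

lemma Iso.trans {A B C : CRep F n} (h : A.Iso B) (h' : B.Iso C) : A.Iso C := by
  obtain ⟨φ, hφ⟩ := h
  obtain ⟨ψ, hψ⟩ := h'
  refine ⟨⟨fun j => (ψ.f j).comp (φ.f j), fun j => ?_⟩, fun j => (hψ j).comp (hφ j)⟩
  rw [LinearMap.comp_assoc, φ.comm, ← LinearMap.comp_assoc, ψ.comm, LinearMap.comp_assoc]

lemma Iso.finrank_eq {M N : CRep F n} (h : M.Iso N) (j : ZMod n) :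
    Module.finrank F (M.V j) = Module.finrank F (N.V j) := by
  obtain ⟨φ, hφ⟩ := h
  exact (LinearEquiv.ofBijective (φ.f j) (hφ j)).finrank_eq

lemma Iso.topDim_eq [NeZero n] {M N : CRep F n} (h : M.Iso N) : M.topDim = N.topDim := by
  obtain ⟨φ, hφ⟩ := h
  refine Finset.sum_congr rfl fun j _ => ?_
  refine (Submodule.Quotient.equiv _ _ (LinearEquiv.ofBijective (φ.f (j - 1)) (hφ (j - 1)))
    ?_).finrank_eq
  change Submodule.map (φ.f (j - 1)) _ = _
  rw [← LinearMap.range_comp, φ.comm, LinearMap.range_comp,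
    LinearMap.range_eq_top.2 (hφ j).2, Submodule.map_top]

lemma topDim_pi [NeZero n] {ι : Type} [Fintype ι] (W : ι → CRep F n) :
    (pi W).topDim = ∑ i, (W i).topDim := by
  classical
  simp only [topDim]
  rw [Finset.sum_comm]
  refine Finset.sum_congr rfl fun j _ => ?_
  have hr : LinearMap.range ((pi W).x j)
      = Submodule.pi Set.univ fun i => LinearMap.range ((W i).x j) := by
    ext v
    refine Iff.trans ?_ Submodule.mem_pi.symm
    constructor
    · rintro ⟨w, rfl⟩ i -
      exact ⟨w i, rfl⟩
    · intro h
      choose w hw using fun i => h i (Set.mem_univ i)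
      exact ⟨w, funext hw⟩
  rw [hr]
  refine (Submodule.quotientPi fun i => LinearMap.range ((W i).x j)).finrank_eq.trans ?_
  exact Module.finrank_pi_fintype F

lemma IsNilpotentRep.of_iso {M N : CRep F n} (hM : M.IsNilpotentRep) (h : M.Iso N) :
    N.IsNilpotentRep := by
  obtain ⟨φ, hφ⟩ := h
  exact hM.of_surjective φ fun j => (hφ j).2

lemma IsNilpotentRep.of_pi {ι : Type} [Fintype ι] {W : ι → CRep F n}
    (h : (pi W).IsNilpotentRep) (i : ι) : (W i).IsNilpotentRep := by
  classical
  refine h.of_surjective ⟨fun j => LinearMap.proj i, fun j => rfl⟩ fun j v => ?_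
  exact ⟨Pi.single (M := fun i => (W i).V j) i v, Pi.single_eq_same (M := fun i => (W i).V j) i v⟩

lemma hasLen.topDim_eq [NeZero n] {M : CRep F n} {k : ℕ} (hk : M.hasLen k)
    (hM : M.IsNilpotentRep) : M.topDim = k := by
  obtain ⟨W, hW, hiso⟩ := hk
  rw [hiso.topDim_eq, topDim_pi,
    Finset.sum_congr rfl fun i _ => (hW i).topDim_eq_one ((hM.of_iso hiso).of_pi i)]
  simp

lemma pi_iso_of_equiv {ι κ : Type} [Fintype ι] [Fintype κ] (e : κ ≃ ι) (W : ι → CRep F n) :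
    (pi W).Iso (pi fun i => W (e i)) := by
  refine ⟨⟨fun j => LinearMap.pi fun i => LinearMap.proj (e i), fun j => rfl⟩, fun j => ?_⟩
  exact (Equiv.piCongrLeft' (fun i => (W i).V j) e.symm).bijective

lemma prod_iso_pi_sumElim {ι κ : Type} [Fintype ι] [Fintype κ] {A B : CRep F n}
    {W : ι → CRep F n} {W' : κ → CRep F n} (hA : A.Iso (pi W)) (hB : B.Iso (pi W')) :
    (A.prod B).Iso (pi (Sum.elim W W')) := by
  obtain ⟨φ, hφ⟩ := hA
  obtain ⟨ψ, hψ⟩ := hB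
  refine ⟨⟨fun j => LinearMap.pi fun i => match i with
    | Sum.inl i => (LinearMap.proj i).comp ((φ.f j).comp (LinearMap.fst F (A.V j) (B.V j)))
    | Sum.inr i => (LinearMap.proj i).comp ((ψ.f j).comp (LinearMap.snd F (A.V j) (B.V j))),
    fun j => ?_⟩, fun j => ⟨?_, ?_⟩⟩
  · refine LinearMap.ext fun v => funext fun i => ?_
    rcases i with i | i
    · exact congrFun (LinearMap.congr_fun (φ.comm j) v.1) i
    · exact congrFun (LinearMap.congr_fun (ψ.comm j) v.2) i
  · rintro ⟨a, b⟩ ⟨a', b'⟩ h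
    refine Prod.ext ((hφ j).1 (funext fun i => ?_)) ((hψ j).1 (funext fun i => ?_))
    · exact congrFun h (Sum.inl i)
    · exact congrFun h (Sum.inr i)
  · intro w
    obtain ⟨a, ha⟩ := (hφ j).2 fun i => w (Sum.inl i)
    obtain ⟨b, hb⟩ := (hψ j).2 fun i => w (Sum.inr i)
    refine ⟨(a, b), funext fun i => ?_⟩
    rcases i with i | i
    · exact congrFun ha i
    · exact congrFun hb i

lemma isZero_iff_totalDim [NeZero n] {M : CRep F n} : M.IsZero ↔ M.totalDim = 0 := by
  simp [IsZero, totalDim, Finset.sum_eq_zero_iff, Module.finrank_zero_iff]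

lemma Iso.totalDim_prod [NeZero n] {M A B : CRep F n} (h : M.Iso (A.prod B)) :
    M.totalDim = A.totalDim + B.totalDim := by
  rw [totalDim, totalDim, totalDim, ← Finset.sum_add_distrib]
  refine Finset.sum_congr rfl fun j _ => ?_
  rw [h.finrank_eq j]
  exact Module.finrank_prod

lemma exists_hasLen [NeZero n] (M : CRep F n) : ∃ k, M.hasLen k := by
  induction hd : M.totalDim using Nat.strong_induction_on generalizing M with
  | _ d ih =>
    by_cases h0 : M.IsZero
    · refine ⟨0, Fin.elim0, fun i => i.elim0, ⟨fun j => 0, fun j => by simp⟩, fun j => ?_⟩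
      have := h0 j
      have : Subsingleton ((pi (Fin.elim0 : Fin 0 → CRep F n)).V j) :=
        ⟨fun a b => funext fun i => i.elim0⟩
      exact ⟨fun a b _ => Subsingleton.elim _ _, fun b => ⟨0, Subsingleton.elim _ _⟩⟩
    by_cases hI : M.Indecomp
    · refine ⟨1, fun _ => M, fun _ => hI, ⟨fun j => LinearMap.pi fun _ => LinearMap.id,
        fun j => rfl⟩, fun j => ⟨fun a b h => congrFun h 0, fun b => ⟨b 0, funext fun i => ?_⟩⟩⟩
      rw [Subsingleton.elim i 0]
      rfl
    · simp only [Indecomp, not_and, not_forall, not_or] at hI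
      obtain ⟨A, B, hiso, hA, hB⟩ := hI h0
      rw [isZero_iff_totalDim] at hA hB
      have hdim := hiso.totalDim_prod
      obtain ⟨k, W, hW, hWA⟩ := ih A.totalDim (by omega) A rfl
      obtain ⟨l, W', hW', hWB⟩ := ih B.totalDim (by omega) B rfl
      refine ⟨k + l, fun i => Sum.elim W W' (finSumFinEquiv.symm i), fun i => ?_,
        (hiso.trans (prod_iso_pi_sumElim hWA hWB)).trans (pi_iso_of_equiv finSumFinEquiv.symm _)⟩
      change (Sum.elim W W' (finSumFinEquiv.symm i)).Indecomp
      rcases finSumFinEquiv.symm i with i | i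
      · exact hW i
      · exact hW' i

/-- For a nilpotent representation the number of indecomposable summands is the dimension of
the top. -/
lemma IsNilpotentRep.hasLen_iff [NeZero n] {M : CRep F n} (hM : M.IsNilpotentRep) (k : ℕ) :
    M.hasLen k ↔ M.topDim = k := by
  refine ⟨fun h => h.topDim_eq hM, ?_⟩
  rintro rfl
  obtain ⟨k, hk⟩ := M.exists_hasLen
  rwa [hk.topDim_eq hM]

end CRep

namespace CRep

variable {F : Type} [Field F] {n : ℕ}

/-! ### Extensions and cocycles -/

/-- Degree-preserving families of linear maps. -/
abbrev Cochain₀ (M N : CRep F n) : Type := ∀ j, M.V j →ₗ[F] N.V j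

/-- Families of linear maps lowering the degree by one. -/
abbrev Cochain₁ (M N : CRep F n) : Type := ∀ j, M.V j →ₗ[F] N.V (j - 1)

/-- The differential whose kernel is `Hom(M, N)` and whose cokernel is `Ext¹(M, N)`. -/
def diff (M N : CRep F n) : Cochain₀ M N →ₗ[F] Cochain₁ M N where
  toFun f j := (f (j - 1)).comp (M.x j) - (N.x j).comp (f j)
  map_add' f g := by
    ext j v
    simp only [Pi.add_apply, LinearMap.sub_apply, LinearMap.comp_apply, LinearMap.add_apply,
      map_add]
    abel
  map_smul' c f := by
    ext j v
    simp [smul_sub]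

@[simp]
lemma diff_apply {M N : CRep F n} (f : Cochain₀ M N) (j : ZMod n) (v : M.V j) :
    diff M N f j v = f (j - 1) (M.x j v) - N.x j (f j v) := rfl

/-- Morphisms are the kernel of the differential. -/
def homEquivKer (M N : CRep F n) : Hom M N ≃ LinearMap.ker (diff M N) where
  toFun φ := ⟨φ.f, by
    rw [LinearMap.mem_ker]
    funext j
    exact sub_eq_zero.2 (φ.comm j)⟩
  invFun f := ⟨f.1, fun j => sub_eq_zero.1 (congrFun (LinearMap.mem_ker.1 f.2) j)⟩
  left_inv _ := rfl
  right_inv _ := rfl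

/-- `h` is the cocycle of the short exact sequence `s` for some choice of linear sections. -/
def IsCocycle {N M : CRep F n} (s : SES N M) (h : Cochain₁ M N) : Prop :=
  ∃ σ : Cochain₀ M s.E, (∀ j v, s.p.f j (σ j v) = v) ∧
    ∀ j v, s.E.x j (σ j v) = σ (j - 1) (M.x j v) + s.i.f (j - 1) (h j v)

lemma Hom.comm_apply {M N : CRep F n} (φ : Hom M N) (j : ZMod n) (v : M.V j) :
    φ.f (j - 1) (M.x j v) = N.x j (φ.f j v) := LinearMap.congr_fun (φ.comm j) v

lemma SES.p_i {N M : CRep F n} (s : SES N M) (j : ZMod n) (v : N.V j) :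
    s.p.f j (s.i.f j v) = 0 := by
  have : s.i.f j v ∈ LinearMap.ker (s.p.f j) := s.exct j ▸ ⟨v, rfl⟩
  exact this

/-- A linear map with values in the kernel of the projection factors through the inclusion. -/
lemma SES.exists_lift {N M : CRep F n} (s : SES N M) (j : ZMod n) {X : Type} [AddCommGroup X]
    [Module F X] (g : X →ₗ[F] s.E.V j) (hg : ∀ v, s.p.f j (g v) = 0) :
    ∃ g' : X →ₗ[F] N.V j, ∀ v, s.i.f j (g' v) = g v := by
  obtain ⟨r, hr⟩ := LinearMap.exists_leftInverse_of_injective (s.i.f j)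
    (LinearMap.ker_eq_bot.2 (s.inj j))
  refine ⟨r.comp g, fun v => ?_⟩
  have : g v ∈ LinearMap.range (s.i.f j) := by rw [s.exct j]; exact hg v
  obtain ⟨w, hw⟩ := this
  rw [LinearMap.comp_apply, ← hw]
  exact congrArg _ (LinearMap.congr_fun hr w)

lemma exists_isCocycle {N M : CRep F n} (s : SES N M) : ∃ h, IsCocycle s h := by
  choose σ hσ using fun j => LinearMap.exists_rightInverse_of_surjective (s.p.f j)
    (LinearMap.range_eq_top.2 (s.surj j))
  have hσ' : ∀ j v, s.p.f j (σ j v) = v := fun j v => LinearMap.congr_fun (hσ j) v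
  choose h hh using fun j => s.exists_lift (j - 1)
    ((s.E.x j).comp (σ j) - (σ (j - 1)).comp (M.x j)) (fun v => by
      rw [LinearMap.sub_apply, LinearMap.comp_apply, LinearMap.comp_apply, map_sub, hσ',
        s.p.comm_apply, hσ', sub_self])
  refine ⟨h, σ, hσ', fun j v => ?_⟩
  rw [hh, LinearMap.sub_apply, LinearMap.comp_apply, LinearMap.comp_apply]
  abel

lemma BaerEq.sub_mem {N M : CRep F n} {s s' : SES N M} (hs : BaerEq s s') {h h' : Cochain₁ M N}
    (hh : IsCocycle s h) (hh' : IsCocycle s' h') : h - h' ∈ LinearMap.range (diff M N) := by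
  obtain ⟨φ, hφi, hφp⟩ := hs
  obtain ⟨σ, hσ, hσx⟩ := hh
  obtain ⟨σ', hσ', hσx'⟩ := hh'
  have hi : ∀ j v, φ.f j (s.i.f j v) = s'.i.f j v := fun j v => LinearMap.congr_fun (hφi j) v
  have hp : ∀ j v, s'.p.f j (φ.f j v) = s.p.f j v := fun j v => LinearMap.congr_fun (hφp j) v
  choose f hf using fun j => s'.exists_lift j (σ' j - (φ.f j).comp (σ j)) (fun v => by
    rw [LinearMap.sub_apply, LinearMap.comp_apply, map_sub, hp, hσ, hσ', sub_self])
  refine ⟨f, ?_⟩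
  ext j v
  apply s'.inj (j - 1)
  have h1 := congrArg (φ.f (j - 1)) (hσx j v)
  rw [map_add, hi, φ.comm_apply] at h1
  have h2 := hσx' j v
  rw [diff_apply, Pi.sub_apply, LinearMap.sub_apply, map_sub, map_sub, hf, s'.i.comm_apply, hf]
  simp only [LinearMap.sub_apply, LinearMap.comp_apply, map_sub]
  rw [h1, h2]
  abel

lemma baerEq_of_sub_mem {N M : CRep F n} {s s' : SES N M} {h h' : Cochain₁ M N}
    (hh : IsCocycle s h) (hh' : IsCocycle s' h') (hd : h - h' ∈ LinearMap.range (diff M N)) :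
    BaerEq s s' := by
  obtain ⟨σ, hσ, hσx⟩ := hh
  obtain ⟨σ', hσ', hσx'⟩ := hh'
  obtain ⟨f, hf⟩ := hd
  choose ρ hρ using fun j => s.exists_lift j (LinearMap.id - (σ j).comp (s.p.f j)) (fun v => by
    rw [LinearMap.sub_apply, LinearMap.comp_apply, map_sub, hσ, LinearMap.id_apply, sub_self])
  simp only [LinearMap.sub_apply, LinearMap.comp_apply, LinearMap.id_apply] at hρ
  have hρi : ∀ j v, ρ j (s.i.f j v) = v := fun j v => by
    apply s.inj j
    rw [hρ, s.p_i, map_zero, sub_zero]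
  have hρx : ∀ j v, ρ (j - 1) (s.E.x j v) = N.x j (ρ j v) + h j (s.p.f j v) := fun j v => by
    apply s.inj (j - 1)
    have h1 := hσx j (s.p.f j v)
    rw [hρ, map_add, s.i.comm_apply, hρ, map_sub, h1, s.p.comm_apply]
    abel
  have hff : ∀ j v, h j v = h' j v + (f (j - 1) (M.x j v) - N.x j (f j v)) := fun j v => by
    have := LinearMap.congr_fun (congrFun hf j) v
    rw [diff_apply] at this
    rw [this]
    simp
  refine ⟨⟨fun j => (s'.i.f j).comp (ρ j - (f j).comp (s.p.f j)) + (σ' j).comp (s.p.f j),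
    fun j => ?_⟩, fun j => ?_, fun j => ?_⟩
  · ext v
    simp only [LinearMap.add_apply, LinearMap.sub_apply, LinearMap.comp_apply, map_add, map_sub]
    rw [hρx, s.p.comm_apply, hff, hσx', ← s'.i.comm_apply, ← s'.i.comm_apply]
    simp only [map_add, map_sub]
    abel
  · ext v
    simp [hρi, s.p_i]
  · ext v
    simp [hσ', s'.p_i]

/-- The short exact sequence attached to a cocycle. -/
def SES.ofCocycle {N M : CRep F n} (h : Cochain₁ M N) : SES N M where
  E :=
    { V := fun j => N.V j × M.V j
      x := fun j => ((N.x j).comp (LinearMap.fst F _ _) + (h j).comp (LinearMap.snd F _ _)).prod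
        ((M.x j).comp (LinearMap.snd F _ _)) }
  i := ⟨fun j => LinearMap.inl F _ _, fun j => by ext v <;> simp⟩
  p := ⟨fun j => LinearMap.snd F _ _, fun j => by ext v <;> simp⟩
  inj _ := LinearMap.inl_injective
  surj _ := LinearMap.snd_surjective
  exct _ := LinearMap.range_inl F _ _

lemma SES.isCocycle_ofCocycle {N M : CRep F n} (h : Cochain₁ M N) :
    IsCocycle (SES.ofCocycle h) h := by
  refine ⟨fun j => LinearMap.inr F _ _, fun j v => rfl, fun j v => Prod.ext ?_ ?_⟩
  · change N.x j 0 + h j v = 0 + h j v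
    rw [map_zero]
  · exact (add_zero _).symm

lemma SES.Splits.mem_range {N M : CRep F n} {s : SES N M} (hs : s.Splits) {h : Cochain₁ M N}
    (hh : IsCocycle s h) : h ∈ LinearMap.range (diff M N) := by
  obtain ⟨σ, hσ⟩ := hs
  have h0 : IsCocycle s (0 : Cochain₁ M N) :=
    ⟨σ.f, fun j v => LinearMap.congr_fun (hσ j) v, fun j v => by
      rw [σ.comm_apply]; simp⟩
  have hrefl : BaerEq s s := ⟨⟨fun j => LinearMap.id, fun j => rfl⟩, fun j => rfl, fun j => rfl⟩
  simpa using hrefl.sub_mem hh h0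

/-- If a property of the middle term is detected by a subspace `K` of cocycles, the number of
extension classes with this property is the cardinality of the image of `K` in `Ext¹`. -/
lemma extCount_eq {N M : CRep F n} {P : CRep F n → Prop} (K : Submodule F (Cochain₁ M N))
    (hK : ∀ (s : SES N M) (h : Cochain₁ M N), IsCocycle s h → (P s.E ↔ h ∈ K)) :
    extCount N M P = Nat.card (K.map (LinearMap.range (diff M N)).mkQ) := by
  choose c hc using fun s : SES N M => exists_isCocycle s
  refine Nat.card_congr (Equiv.ofBijective (Quot.lift (fun s => ⟨Submodule.mkQ _ (c s.1),
    Submodule.mem_map_of_mem ((hK s.1 _ (hc s.1)).1 s.2)⟩) ?_) ⟨?_, ?_⟩)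
  · intro s s' hs
    exact Subtype.ext ((Submodule.Quotient.eq _).2 (hs.sub_mem (hc _) (hc _)))
  · rintro ⟨s⟩ ⟨s'⟩ hss
    exact Quot.sound (baerEq_of_sub_mem (hc _) (hc _)
      ((Submodule.Quotient.eq _).1 (congrArg Subtype.val hss)))
  · rintro ⟨_, h, hh, rfl⟩
    refine ⟨Quot.mk _ ⟨SES.ofCocycle h, (hK _ h (SES.isCocycle_ofCocycle h)).2 hh⟩,
      Subtype.ext ((Submodule.Quotient.eq _).2 ?_)⟩
    have hrefl : BaerEq (SES.ofCocycle h) (SES.ofCocycle h) :=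
      ⟨⟨fun j => LinearMap.id, fun j => rfl⟩, fun j => rfl, fun j => rfl⟩
    exact hrefl.sub_mem (hc _) (SES.isCocycle_ofCocycle h)

/-! ### Tops of extensions -/

lemma finrank_range_extension {N M : CRep F n} {s : SES N M} {h : Cochain₁ M N}
    (hh : IsCocycle s h) (j : ZMod n) :
    Module.finrank F (LinearMap.range (s.E.x j)) = Module.finrank F (LinearMap.range (M.x j)) +
      Module.finrank F ↥(LinearMap.range (N.x j) ⊔ (LinearMap.ker (M.x j)).map (h j)) := by
  obtain ⟨σ, hσ, hσx⟩ := hh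
  have h1 := LinearMap.finrank_range_add_finrank_ker
    ((s.p.f (j - 1)).domRestrict (LinearMap.range (s.E.x j)))
  rw [LinearMap.range_domRestrict, ← LinearMap.range_comp, s.p.comm, LinearMap.range_comp,
    LinearMap.range_eq_top.2 (s.surj j), Submodule.map_top] at h1
  rw [← h1, add_right_inj]
  rw [← Submodule.finrank_map_subtype_eq,
    (Submodule.equivMapOfInjective (s.i.f (j - 1)) (s.inj (j - 1)) _).finrank_eq]
  suffices heq : Submodule.map (LinearMap.range (s.E.x j)).subtype
      (LinearMap.ker ((s.p.f (j - 1)).domRestrict (LinearMap.range (s.E.x j)))) =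
      Submodule.map (s.i.f (j - 1))
        (LinearMap.range (N.x j) ⊔ (LinearMap.ker (M.x j)).map (h j)) by rw [heq]
  apply le_antisymm
  · rintro _ ⟨⟨_, e, rfl⟩, he, rfl⟩
    have hk : M.x j (s.p.f j e) = 0 := by
      rw [← s.p.comm_apply]; exact he
    have hlift : e - σ j (s.p.f j e) ∈ LinearMap.range (s.i.f j) := by
      rw [s.exct j, LinearMap.mem_ker, map_sub, hσ, sub_self]
    obtain ⟨w, hw⟩ := hlift
    have hx : s.E.x j e = s.i.f (j - 1) (N.x j w + h j (s.p.f j e)) := by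
      have h2 := hσx j (s.p.f j e)
      rw [hk, map_zero, zero_add] at h2
      rw [map_add, ← h2, s.i.comm_apply, hw, ← map_add, sub_add_cancel]
    exact ⟨_, add_mem (Submodule.mem_sup_left ⟨w, rfl⟩)
      (Submodule.mem_sup_right ⟨_, hk, rfl⟩), hx.symm⟩
  · rw [Submodule.map_le_iff_le_comap, sup_le_iff]
    constructor
    · rintro _ ⟨w, rfl⟩
      refine ⟨⟨_, s.i.f j w, rfl⟩, ?_, (s.i.comm_apply j w).symm⟩
      change s.p.f (j - 1) (s.E.x j (s.i.f j w)) = 0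
      rw [s.p.comm_apply, s.p_i, map_zero]
    · rintro _ ⟨m, hm, rfl⟩
      have h2 := hσx j m
      rw [LinearMap.mem_ker.1 hm, map_zero, zero_add] at h2
      refine ⟨⟨_, σ j m, rfl⟩, ?_, h2⟩
      change s.p.f (j - 1) (s.E.x j (σ j m)) = 0
      rw [s.p.comm_apply, hσ]
      exact hm

lemma SES.finrank_eq {N M : CRep F n} (s : SES N M) (j : ZMod n) :
    Module.finrank F (s.E.V j) = Module.finrank F (M.V j) + Module.finrank F (N.V j) := by
  rw [← LinearMap.finrank_range_add_finrank_ker (s.p.f j), ← s.exct j,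
    LinearMap.finrank_range_of_inj (s.inj j), LinearMap.range_eq_top.2 (s.surj j), finrank_top]

lemma topDim_extension_eq_iff [NeZero n] {N M : CRep F n} {s : SES N M} {h : Cochain₁ M N}
    (hh : IsCocycle s h) : s.E.topDim = M.topDim + N.topDim ↔
      ∀ j, (LinearMap.ker (M.x j)).map (h j) ≤ LinearMap.range (N.x j) := by
  have hle : ∀ j, LinearMap.range (N.x j) ≤
      LinearMap.range (N.x j) ⊔ (LinearMap.ker (M.x j)).map (h j) := fun j => le_sup_left
  have key : ∀ j, Module.finrank F (s.E.V (j - 1) ⧸ LinearMap.range (s.E.x j)) +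
      Module.finrank F ↥(LinearMap.range (N.x j) ⊔ (LinearMap.ker (M.x j)).map (h j)) =
      Module.finrank F (M.V (j - 1) ⧸ LinearMap.range (M.x j)) +
      Module.finrank F (N.V (j - 1) ⧸ LinearMap.range (N.x j)) +
      Module.finrank F (LinearMap.range (N.x j)) := fun j => by
    have h1 := finrank_range_extension hh j
    have h2 := s.finrank_eq (j - 1)
    rw [← (LinearMap.range (s.E.x j)).finrank_quotient_add_finrank,
      ← (LinearMap.range (M.x j)).finrank_quotient_add_finrank,
      ← (LinearMap.range (N.x j)).finrank_quotient_add_finrank] at h2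
    omega
  rw [topDim, topDim, topDim, ← Finset.sum_add_distrib, Finset.sum_eq_sum_iff_of_le]
  · refine ⟨fun H j => ?_, fun H j _ => ?_⟩
    · have h3 := H j (Finset.mem_univ j)
      have h4 := key j
      have h5 := Submodule.eq_of_le_of_finrank_eq (hle j) (by omega)
      rw [h5]
      exact le_sup_right
    · have h4 := key j
      rw [sup_eq_left.2 (H j)] at h4
      omega
  · intro j _
    have h4 := key j
    have h5 := Submodule.finrank_mono (hle j)
    omega

end CRep

namespace CRep

variable {F : Type} [Field F] {n : ℕ}

/-! ### Counting extensions with large middle term -/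

/-- Cochains mapping `ker x_c` into the image of `x_c` at the vertex `c`. -/
def kerToRange (M N : CRep F n) (c : ZMod n) : Submodule F (Cochain₁ M N) where
  carrier := {h | (LinearMap.ker (M.x c)).map (h c) ≤ LinearMap.range (N.x c)}
  zero_mem' := by
    rintro _ ⟨m, -, rfl⟩
    exact zero_mem _
  add_mem' := by
    rintro h h' hh hh' _ ⟨m, hm, rfl⟩
    exact add_mem (hh ⟨m, hm, rfl⟩) (hh' ⟨m, hm, rfl⟩)
  smul_mem' := by
    rintro a h hh _ ⟨m, hm, rfl⟩
    exact Submodule.smul_mem _ a (hh ⟨m, hm, rfl⟩)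

lemma mem_kerToRange {M N : CRep F n} {c : ZMod n} {h : Cochain₁ M N} :
    h ∈ kerToRange M N c ↔ (LinearMap.ker (M.x c)).map (h c) ≤ LinearMap.range (N.x c) :=
  Iff.rfl

lemma range_diff_le_kerToRange (M N : CRep F n) (c : ZMod n) :
    LinearMap.range (diff M N) ≤ kerToRange M N c := by
  rintro _ ⟨f, rfl⟩ _ ⟨m, hm, rfl⟩
  rw [diff_apply, LinearMap.mem_ker.1 hm, map_zero, zero_sub]
  exact neg_mem ⟨_, rfl⟩

lemma finrank_kerToRange [NeZero n] (M N : CRep F n) (c : ZMod n)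
    (hc : Module.finrank F (N.V (c - 1) ⧸ LinearMap.range (N.x c)) = 1) :
    Module.finrank F (kerToRange M N c) + Module.finrank F (LinearMap.ker (M.x c)) =
      Module.finrank F (Cochain₁ M N) := by
  let ρ : Cochain₁ M N →ₗ[F]
      (LinearMap.ker (M.x c) →ₗ[F] N.V (c - 1) ⧸ LinearMap.range (N.x c)) :=
    { toFun := fun h => ((LinearMap.range (N.x c)).mkQ.comp (h c)).comp
        (LinearMap.ker (M.x c)).subtype
      map_add' := fun h h' => by ext; simp
      map_smul' := fun a h => by ext; simp }
  have hker : LinearMap.ker ρ = kerToRange M N c := by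
    ext h
    rw [LinearMap.mem_ker, mem_kerToRange]
    constructor
    · rintro hh _ ⟨m, hm, rfl⟩
      exact (Submodule.Quotient.mk_eq_zero _).1 (LinearMap.congr_fun hh ⟨m, hm⟩)
    · intro hh
      ext m
      exact (Submodule.Quotient.mk_eq_zero _).2 (hh ⟨m, m.2, rfl⟩)
  have hsurj : Function.Surjective ρ := by
    intro g
    obtain ⟨r, hr⟩ := LinearMap.exists_rightInverse_of_surjective
      (LinearMap.range (N.x c)).mkQ (LinearMap.range_eq_top.2 (Submodule.mkQ_surjective _))
    obtain ⟨g', hg'⟩ := LinearMap.exists_extend (r.comp g)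
    refine ⟨Function.update 0 c g', LinearMap.ext fun m => ?_⟩
    change Submodule.mkQ _ ((Function.update (0 : Cochain₁ M N) c g' c) m) = _
    rw [Function.update_self]
    have h1 := LinearMap.congr_fun hg' m
    have h2 := LinearMap.congr_fun hr (g m)
    simp only [LinearMap.comp_apply, Submodule.subtype_apply, LinearMap.id_apply] at h1 h2
    rw [h1, h2]
  have h1 := LinearMap.finrank_range_add_finrank_ker ρ
  rw [hker, LinearMap.range_eq_top.2 hsurj, finrank_top, Module.finrank_linearMap, hc,
    mul_one] at h1
  omega

lemma finrank_map_mkQ {V : Type} [AddCommGroup V] [Module F V] [Module.Finite F V]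
    {D K : Submodule F V} (h : D ≤ K) :
    Module.finrank F (K.map D.mkQ) + Module.finrank F D = Module.finrank F K := by
  have h1 := LinearMap.finrank_range_add_finrank_ker (D.mkQ.domRestrict K)
  rw [LinearMap.range_domRestrict, LinearMap.ker_domRestrict, Submodule.ker_mkQ] at h1
  rw [← h1, add_right_inj]
  exact (Submodule.comapSubtypeEquivOfLe h).finrank_eq.symm

/-! ### Solving for coboundaries -/

lemma exists_comp_eq {A B C : Type} [AddCommGroup A] [Module F A] [AddCommGroup B] [Module F B]
    [AddCommGroup C] [Module F C] (x : A →ₗ[F] B) (y : A →ₗ[F] C)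
    (h : LinearMap.ker x ≤ LinearMap.ker y) : ∃ g : B →ₗ[F] C, g.comp x = y := by
  obtain ⟨g, hg⟩ := LinearMap.exists_extend
    (((LinearMap.ker x).liftQ y h).comp x.quotKerEquivRange.symm.toLinearMap)
  refine ⟨g, LinearMap.ext fun a => ?_⟩
  have h1 := LinearMap.congr_fun hg ⟨x a, a, rfl⟩
  have h2 : x.quotKerEquivRange.symm ⟨x a, a, rfl⟩ = Submodule.Quotient.mk a := by
    rw [LinearEquiv.symm_apply_eq]
    exact Subtype.ext rfl
  simp only [LinearMap.comp_apply, LinearEquiv.coe_coe] at h1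
  rw [h2] at h1
  exact h1

lemma exists_diff_eq_update [NeZero n] (hn : 2 ≤ n) {M N : CRep F n} (h : Cochain₁ M N)
    (f : Cochain₀ M N) (v : ZMod n)
    (hv : ∀ m, M.x v m = 0 → h v m + N.x v (f v m) = 0) :
    ∃ f' : Cochain₀ M N, diff M N f' v = h v ∧
      ∀ w, w ≠ v → w ≠ v - 1 → diff M N f' w = diff M N f w := by
  have : Fact (1 < n) := ⟨hn⟩
  obtain ⟨g, hg⟩ := exists_comp_eq (M.x v) (h v + (N.x v).comp (f v)) hv
  refine ⟨Function.update f (v - 1) g, ?_, fun w hw hw' => ?_⟩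
  · ext m
    have hne : v ≠ v - 1 := by simp [eq_sub_iff_add_eq]
    have hg' := LinearMap.congr_fun hg m
    simp only [LinearMap.comp_apply, LinearMap.add_apply] at hg'
    rw [diff_apply, Function.update_self, Function.update_of_ne hne, hg', add_sub_cancel_right]
  · ext m
    have hne : w - 1 ≠ v - 1 := by simpa using hw
    rw [diff_apply, diff_apply, Function.update_of_ne hne, Function.update_of_ne hw']

lemma natCast_inj_of_lt {a b : ℕ} (ha : a < n) (hb : b < n) (h : (a : ZMod n) = b) : a = b := by
  rw [ZMod.natCast_eq_natCast_iff'] at h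
  rwa [Nat.mod_eq_of_lt ha, Nat.mod_eq_of_lt hb] at h

lemma kerToRange_le_range_diff [NeZero n] (hn : 2 ≤ n) {M N : CRep F n}
    (hN : Subsingleton (N.V 1))
    (hM : ∀ t : ℕ, 1 ≤ t → t ≤ n - 2 → Function.Injective (M.x (1 - (t : ZMod n)))) :
    kerToRange M N 1 ≤ LinearMap.range (diff M N) := by
  intro h hh
  have key : ∀ i : ℕ, i ≤ n - 1 → ∃ f : Cochain₀ M N,
      ∀ t : ℕ, t < i → ∀ v : ZMod n, v = 1 - t → diff M N f v = h v := by
    intro i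
    induction i with
    | zero => exact fun _ => ⟨0, fun t ht => absurd ht (by omega)⟩
    | succ i ih =>
      intro hi
      obtain ⟨f, hf⟩ := ih (by omega)
      obtain ⟨f', hf', hff'⟩ := exists_diff_eq_update hn h f (1 - (i : ZMod n)) (by
        intro m hm
        rcases Nat.eq_zero_or_pos i with rfl | hpos
        · have : (1 - ((0 : ℕ) : ZMod n)) = 1 := by simp
          revert m
          rw [this]
          intro m hm
          have hz : ∀ y : N.V 1, N.x 1 y = 0 := fun y => by
            rw [Subsingleton.elim y 0, map_zero]
          obtain ⟨y, hy⟩ := hh ⟨m, hm, rfl⟩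
          rw [hz] at hy
          rw [hz, ← hy, add_zero]
        · have : m = 0 := hM i hpos (by omega) (by rw [hm, map_zero])
          subst this
          simp)
      refine ⟨f', fun t ht v hv => ?_⟩
      rcases Nat.lt_succ_iff_lt_or_eq.1 ht with hlt | rfl
      · rw [hff' v, hf t hlt v hv]
        · rintro rfl
          have : (t : ZMod n) = i := (sub_right_inj.1 hv).symm
          exact hlt.ne (natCast_inj_of_lt (by omega) (by omega) this)
        · intro hv'
          rw [hv] at hv'
          have : ((t : ℕ) : ZMod n) = ((i + 1 : ℕ) : ZMod n) := by
            push_cast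
            linear_combination -hv'
          have := natCast_inj_of_lt (by omega) (by omega) this
          omega
      · subst hv
        exact hf'
  obtain ⟨f, hf⟩ := key (n - 1) le_rfl
  refine ⟨f, funext fun v => ?_⟩
  have hv : v = 1 - (((1 - v : ZMod n).val : ℕ) : ZMod n) := by
    rw [ZMod.natCast_zmod_val]; ring
  have hlt := ZMod.val_lt (1 - v)
  by_cases h1 : (1 - v).val < n - 1
  · exact hf _ h1 v hv
  · have h2 : (1 - v).val = n - 1 := by omega
    rw [h2, Nat.cast_sub (by omega)] at hv
    have h3 : v - 1 = 1 := by
      rw [hv]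
      simp
    ext m
    have : Subsingleton (N.V (v - 1)) := by rw [h3]; exact hN
    exact Subsingleton.elim _ _

end CRep

namespace CRep

variable {F : Type} [Field F] {n : ℕ}

/-! ### Simple representations -/

/-- The simple representation supported at the vertex `j`. -/
def simple (F : Type) [Field F] {n : ℕ} (j : ZMod n) : CRep F n where
  V i := PLift (i = j) → F
  x _ := 0

lemma isSja_simple [NeZero n] (j : ZMod n) : IsSja j 1 (simple F j) := by
  have htot : (simple F j).totalDim = 1 := by
    have h : ∀ i, Module.finrank F ((simple F j).V i) = if i = j then 1 else 0 := by
      intro i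
      change Module.finrank F (PLift (i = j) → F) = _
      rw [Module.finrank_pi]
      split_ifs with hij
      · subst hij
        simp
      · exact Fintype.card_eq_zero_iff.2 ⟨fun p => hij p.down⟩
    simp [totalDim, h]
  rw [IsSja, if_neg one_ne_zero]
  refine ⟨⟨1, ?_⟩, ⟨?_, fun A B hAB => ?_⟩, htot, fun hs => ?_⟩
  · rw [pow_one]
    refine DirectSum.linearMap_ext F fun i => LinearMap.ext fun v => ?_
    rw [LinearMap.comp_apply, total_lof]
    exact map_zero _
  · rw [isZero_iff_totalDim, htot]
    exact one_ne_zero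
  · have := hAB.totalDim_prod
    rw [isZero_iff_totalDim, isZero_iff_totalDim]
    omega
  · obtain ⟨v, hv⟩ := hs (fun _ => (1 : F))
    have := congrFun hv ⟨by ring⟩
    exact zero_ne_one this

lemma injective_of_splits {M : CRep F n} (j : ZMod n)
    (hs : ∀ s : SES (simple F j) M, s.Splits) : Function.Injective (M.x (j + 1)) := by
  rw [injective_iff_map_eq_zero]
  intro v hv
  by_contra hne
  obtain ⟨φ, hφ⟩ := Module.Projective.exists_dual_ne_zero F hne
  let h : Cochain₁ M (simple F j) := Function.update 0 (j + 1) (LinearMap.pi fun _ => φ)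
  obtain ⟨f, hf⟩ := (hs (SES.ofCocycle h)).mem_range (SES.isCocycle_ofCocycle h)
  have h1 := LinearMap.congr_fun (congrFun hf (j + 1)) v
  rw [diff_apply, hv, map_zero, zero_sub] at h1
  have h2 : h (j + 1) = LinearMap.pi fun _ => φ := Function.update_self _ _ _
  rw [h2] at h1
  have h3 := congrFun h1 ⟨by ring⟩
  have h4 : (0 : F) = φ v := neg_zero.symm.trans h3
  exact hφ h4.symm

/-! ### The representations with simple top at the vertex `0` -/

lemma IsSja.zero_spec [NeZero n] {a : ℕ} (ha : a ≠ 0) {X : CRep F n}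
    (hX : IsSja (0 : ZMod n) a X) :
    X.IsNilpotentRep ∧ X.totalDim = a ∧ X.topDim = 1 ∧
      Module.finrank F (X.V (1 - 1) ⧸ LinearMap.range (X.x 1)) = 1 ∧
      ∀ j, j ≠ 1 → Function.Surjective (X.x j) := by
  rw [IsSja, if_neg ha, zero_add] at hX
  obtain ⟨hN, hI, hd, hs⟩ := hX
  have ht := hI.topDim_eq_one hN
  have hpos : Module.finrank F (X.V (1 - 1) ⧸ LinearMap.range (X.x 1)) ≠ 0 := by
    rwa [Ne, Module.finrank_zero_iff, Submodule.Quotient.subsingleton_iff,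
      LinearMap.range_eq_top]
  have hsplit := Finset.add_sum_erase Finset.univ
    (fun j => Module.finrank F (X.V (j - 1) ⧸ LinearMap.range (X.x j)))
    (Finset.mem_univ (1 : ZMod n))
  change _ = X.topDim at hsplit
  rw [ht] at hsplit
  refine ⟨hN, hd, ht, by omega, fun j hj => ?_⟩
  have hzero : ∑ j ∈ Finset.univ.erase 1,
      Module.finrank F (X.V (j - 1) ⧸ LinearMap.range (X.x j)) = 0 := by omega
  have := Finset.sum_eq_zero_iff.1 hzero j (Finset.mem_erase.2 ⟨hj, Finset.mem_univ j⟩)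
  rwa [Module.finrank_zero_iff, Submodule.Quotient.subsingleton_iff,
    LinearMap.range_eq_top] at this

lemma finrank_one_le [NeZero n] {X : CRep F n} (hs : ∀ j, j ≠ 1 → Function.Surjective (X.x j))
    (v : ZMod n) : Module.finrank F (X.V 1) ≤ Module.finrank F (X.V v) := by
  have key : ∀ t : ℕ, t < n → ∀ v : ZMod n, v = 1 + t →
      Module.finrank F (X.V 1) ≤ Module.finrank F (X.V v) := by
    intro t
    induction t with
    | zero =>
      intro _ v hv
      rw [hv, Nat.cast_zero, add_zero]
    | succ t ih =>
      intro ht v hv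
      have hv1 : v ≠ 1 := by
        rintro rfl
        have h0 : ((t + 1 : ℕ) : ZMod n) = ((0 : ℕ) : ZMod n) := by
          rw [Nat.cast_zero]
          linear_combination -hv
        have := natCast_inj_of_lt ht (by omega) h0
        omega
      refine (ih (by omega) (v - 1) (by rw [hv]; push_cast; ring)).trans ?_
      exact LinearMap.finrank_le_finrank_of_surjective (hs v hv1)
  exact key (v - 1).val (ZMod.val_lt _) v (by rw [ZMod.natCast_zmod_val]; ring)

lemma finrank_le_zero [NeZero n] {X : CRep F n} (hs : ∀ j, j ≠ 1 → Function.Surjective (X.x j))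
    (v : ZMod n) : Module.finrank F (X.V v) ≤ Module.finrank F (X.V 0) := by
  have key : ∀ t : ℕ, t < n → ∀ v : ZMod n, v = -t →
      Module.finrank F (X.V v) ≤ Module.finrank F (X.V 0) := by
    intro t
    induction t with
    | zero =>
      intro _ v hv
      rw [hv, Nat.cast_zero, neg_zero]
    | succ t ih =>
      intro ht v hv
      obtain ⟨w, rfl⟩ : ∃ w, v = w - 1 := ⟨v + 1, by ring⟩
      have hw : w = -t := by
        push_cast at hv
        linear_combination hv
      have hw1 : w ≠ 1 := by
        intro h1
        have h0 : ((t + 1 : ℕ) : ZMod n) = ((0 : ℕ) : ZMod n) := by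
          push_cast
          linear_combination hw - h1
        have := natCast_inj_of_lt ht (by omega) h0
        omega
      exact (LinearMap.finrank_le_finrank_of_surjective (hs w hw1)).trans (ih (by omega) w hw)
  exact key (-v).val (ZMod.val_lt _) v (by rw [ZMod.natCast_zmod_val]; ring)

lemma finrank_zero_le [NeZero n] {X : CRep F n}
    (hc : Module.finrank F (X.V (1 - 1) ⧸ LinearMap.range (X.x 1)) = 1) :
    Module.finrank F (X.V 0) ≤ Module.finrank F (X.V 1) + 1 := by
  have h1 := (LinearMap.range (X.x 1)).finrank_quotient_add_finrank
  have h2 := LinearMap.finrank_range_le (X.x 1)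
  have h3 : Module.finrank F (X.V (1 - 1)) = Module.finrank F (X.V 0) := by rw [sub_self]
  omega

/-- A representation with simple top at `0` and length divisible by `n` has constant
dimension vector. -/
lemma finrank_eq_of_dvd [NeZero n] {X : CRep F n}
    (hs : ∀ j, j ≠ 1 → Function.Surjective (X.x j))
    (hc : Module.finrank F (X.V (1 - 1) ⧸ LinearMap.range (X.x 1)) = 1)
    (hd : n ∣ X.totalDim) (v : ZMod n) :
    Module.finrank F (X.V v) = Module.finrank F (X.V 1) := by
  set d := Module.finrank F (X.V 1) with hdd
  have hle : ∀ w, d ≤ Module.finrank F (X.V w) := finrank_one_le hs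
  have hge : ∀ w, Module.finrank F (X.V w) ≤ d + 1 := fun w =>
    (finrank_le_zero hs w).trans (finrank_zero_le hc)
  have hsum : X.totalDim = n * d + ∑ w, (Module.finrank F (X.V w) - d) := by
    have : n * d = ∑ _w : ZMod n, d := by simp [ZMod.card]
    rw [this, ← Finset.sum_add_distrib, totalDim]
    exact Finset.sum_congr rfl fun w _ => (Nat.add_sub_cancel' (hle w)).symm
  have hdvd : n ∣ ∑ w, (Module.finrank F (X.V w) - d) :=
    (Nat.dvd_add_right (dvd_mul_right n d)).1 (hsum ▸ hd)
  have hlt : ∑ w, (Module.finrank F (X.V w) - d) < n := by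
    calc ∑ w, (Module.finrank F (X.V w) - d) < ∑ _w : ZMod n, 1 := by
          refine Finset.sum_lt_sum (fun w _ => ?_) ⟨1, Finset.mem_univ _, ?_⟩
          · have := hge w
            omega
          · omega
      _ = n := by simp [ZMod.card]
  have h0 := Nat.eq_zero_of_dvd_of_lt hdvd hlt
  have h1 := Finset.sum_eq_zero_iff.1 h0 v (Finset.mem_univ v)
  have h2 := hle v
  omega

/-- A representation with simple top at `0` and length less than `n` vanishes at `1`. -/
lemma subsingleton_of_totalDim_lt [NeZero n] {X : CRep F n}
    (hs : ∀ j, j ≠ 1 → Function.Surjective (X.x j)) (hd : X.totalDim < n) :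
    Subsingleton (X.V 1) := by
  rw [← Module.finrank_zero_iff (R := F)]
  by_contra h0
  have h1 : n ≤ X.totalDim := by
    calc n = ∑ _w : ZMod n, 1 := by simp [ZMod.card]
      _ ≤ X.totalDim := Finset.sum_le_sum fun w _ => by
        have := finrank_one_le hs w
        omega
  omega

lemma finrank_cochain₀ [NeZero n] (M N : CRep F n) : Module.finrank F (Cochain₀ M N) =
    ∑ j, Module.finrank F (M.V j) * Module.finrank F (N.V j) := by
  rw [Module.finrank_pi_fintype]
  exact Finset.sum_congr rfl fun j _ => Module.finrank_linearMap F F _ _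

lemma finrank_cochain₁ [NeZero n] (M N : CRep F n) : Module.finrank F (Cochain₁ M N) =
    ∑ j, Module.finrank F (M.V j) * Module.finrank F (N.V (j - 1)) := by
  rw [Module.finrank_pi_fintype]
  exact Finset.sum_congr rfl fun j _ => Module.finrank_linearMap F F _ _

end CRep

open CRep in
/-- Lemma 5.9: for `n ≥ 2`, `a ≥ 1` and a nilpotent representation `M` of `C_n` over
a finite field with `Hom(M,S_j) = 0 = Ext¹(M,S_j)` for `2 ≤ j ≤ n-1`, one has
`Σ_{[N] : ℓ(N) = ℓ(M)+1} |Ext¹(M, S_0^{(an)})_N|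
  = |Hom(M, S_0^{(an)})| / |Ext¹(M, S_0^{(n-1)})|`. -/
theorem crep_ext_sum_eq_hom_div_ext
    (F : Type) [Field F] [Fintype F] (n : ℕ) (hn : 2 ≤ n) [NeZero n]
    (a : ℕ) (ha : 1 ≤ a)
    (M : CRep F n) (hM : M.IsNilpotentRep)
    (hperp : ∀ j : ℕ, 2 ≤ j → j ≤ n - 1 → ∀ S : CRep F n, IsSja (j : ZMod n) 1 S →
      Subsingleton (Hom M S) ∧ ∀ s : SES S M, s.Splits)
    (k : ℕ) (hk : M.hasLen k)
    (Sb : CRep F n) (hSb : IsSja (0 : ZMod n) (a * n) Sb)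
    (Ss : CRep F n) (hSs : IsSja (0 : ZMod n) (n - 1) Ss) :
    (extCount Sb M (fun E => E.hasLen (k + 1)) : ℚ) =
      (homCount M Sb : ℚ) / (extCount Ss M (fun _ => True) : ℚ) := by
  classical
  obtain ⟨hbN, hbd, hbt, hbc, hbs⟩ := hSb.zero_spec (Nat.mul_ne_zero (by omega) (by omega))
  obtain ⟨-, hsd, -, hsc, hss⟩ := hSs.zero_spec (by omega)
  have hMt : M.topDim = k := hk.topDim_eq hM
  have hinj : ∀ t : ℕ, 1 ≤ t → t ≤ n - 2 → Function.Injective (M.x (1 - (t : ZMod n))) := by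
    intro t h1 h2
    have h3 := injective_of_splits _
      (hperp (n - t) (by omega) (by omega) _ (isSja_simple _)).2
    have h4 : ((n - t : ℕ) : ZMod n) + 1 = 1 - t := by
      rw [Nat.cast_sub (by omega), ZMod.natCast_self]
      ring
    rwa [h4] at h3
  have hDs : LinearMap.range (diff M Ss) = kerToRange M Ss 1 :=
    le_antisymm (range_diff_le_kerToRange M Ss 1) (kerToRange_le_range_diff hn
      (subsingleton_of_totalDim_lt hss (by omega)) hinj)
  have hb : extCount Sb M (fun E => E.hasLen (k + 1)) =
      Nat.card ((kerToRange M Sb 1).map (LinearMap.range (diff M Sb)).mkQ) := by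
    refine extCount_eq _ fun s h hh => ?_
    rw [(s.isNilpotentRep hbN hM).hasLen_iff, ← hMt, ← hbt, topDim_extension_eq_iff hh,
      mem_kerToRange]
    refine ⟨fun H => H 1, fun H j => ?_⟩
    by_cases hj : j = 1
    · subst hj
      exact H
    · rw [LinearMap.range_eq_top.2 (hbs j hj)]
      exact le_top
  have hs : extCount Ss M (fun _ => True) =
      Nat.card ((⊤ : Submodule F (Cochain₁ M Ss)).map (LinearMap.range (diff M Ss)).mkQ) :=
    extCount_eq _ fun s h hh => by simp
  have hh : homCount M Sb = Nat.card (LinearMap.ker (diff M Sb)) :=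
    Nat.card_congr (homEquivKer M Sb)
  have e1 := finrank_map_mkQ (range_diff_le_kerToRange M Sb 1)
  have e2 := finrank_kerToRange M Sb 1 hbc
  have e3 := LinearMap.finrank_range_add_finrank_ker (diff M Sb)
  have e4 : Module.finrank F (Cochain₀ M Sb) = Module.finrank F (Cochain₁ M Sb) := by
    rw [finrank_cochain₀, finrank_cochain₁]
    refine Finset.sum_congr rfl fun j _ => ?_
    have hdvd : n ∣ Sb.totalDim := hbd ▸ dvd_mul_left n a
    rw [finrank_eq_of_dvd hbs hbc hdvd j, finrank_eq_of_dvd hbs hbc hdvd (j - 1)]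
  have e5 := finrank_map_mkQ (le_top : LinearMap.range (diff M Ss) ≤ ⊤)
  have e6 := finrank_kerToRange M Ss 1 hsc
  rw [finrank_top] at e5
  rw [← hDs] at e6
  have e7 : Module.finrank F (LinearMap.ker (diff M Sb)) =
      Module.finrank F ((kerToRange M Sb 1).map (LinearMap.range (diff M Sb)).mkQ) +
      Module.finrank F
        ((⊤ : Submodule F (Cochain₁ M Ss)).map (LinearMap.range (diff M Ss)).mkQ) := by
    omega
  have hq : (Nat.card F : ℚ) ≠ 0 := Nat.cast_ne_zero.2 Nat.card_pos.ne'
  have hcard : ∀ (V : Type) [AddCommGroup V] [Module F V] [Module.Finite F V],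
      (Nat.card V : ℚ) = (Nat.card F : ℚ) ^ Module.finrank F V := fun V _ _ _ => by
    rw [Module.natCard_eq_pow_finrank (K := F) (V := V), Nat.cast_pow]
  rw [hb, hs, hh,
    hcard ((kerToRange M Sb 1).map (LinearMap.range (diff M Sb)).mkQ),
    hcard (LinearMap.ker (diff M Sb)),
    hcard ((⊤ : Submodule F (Cochain₁ M Ss)).map (LinearMap.range (diff M Ss)).mkQ), e7]
  rw [pow_add, mul_div_cancel_right₀ _ (pow_ne_zero _ hq)]

end
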